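/- arXiv:2208.04288 — 5 statements merged into one kernel-verified Lean document; each statement's English description precedes it below -/
import Mathlib

section
/- Fix a ψ-twisted Feynman–Kac model. Then the predictive marginal measures of the twisted model satisfy γ_0^ψ(S) = (1/M_0(ψ_0)) ∫_S ψ_0(x_0) γ_0(dx_0) for every measurable set S, and for each p ∈ {1, …, n}, γ_p^ψ(S) = ∫_S ψ_p(x_p) γ_p(dx_p) for every measurable set S (i.e., γ_p^ψ has density ψ_p with respect to γ_p). -/
open MeasureTheory ProbabilityTheory ENNReal

noncomputable section

/-- A bounded, strictly positive, measurable `ℝ≥0∞`-valued function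
(a potential or twisting function with values in `(0, ∞)`). -/
def BddPos {X : Type*} [MeasurableSpace X] (f : X → ℝ≥0∞) : Prop :=
  Measurable f ∧ (∀ x, 0 < f x) ∧ ∃ C : ℝ≥0∞, C ≠ ⊤ ∧ ∀ x, f x ≤ C

/-- Predictive marginal measures `γ_p` of a Feynman–Kac model:
`γ_0 = M_0`, `γ_{p+1}(S) = ∫ γ_p(dx) G_p(x) M_{p+1}(x, S)`. -/
def fkGamma {X : Type*} [MeasurableSpace X] (M0 : Measure X)
    (M : ℕ → X → Measure X) (G : ℕ → X → ℝ≥0∞) : ℕ → Measure X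
  | 0 => M0
  | p + 1 => ((fkGamma M0 M G p).withDensity (G p)).bind (M (p + 1))

/-- Updated marginal measures `γ̂_p(S) = ∫_S G_p(x) γ_p(dx)`. -/
def fkGammaHat {X : Type*} [MeasurableSpace X] (M0 : Measure X)
    (M : ℕ → X → Measure X) (G : ℕ → X → ℝ≥0∞) (p : ℕ) : Measure X :=
  (fkGamma M0 M G p).withDensity (G p)

/-- The twist of a measure `μ` by a function `ψ` : `μ^ψ(dx) = μ(dx) ψ(x) / μ(ψ)`. -/
def fkTwist {X : Type*} [MeasurableSpace X] (μ : Measure X) (ψ : X → ℝ≥0∞) : Measure X :=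
  (∫⁻ y, ψ y ∂μ)⁻¹ • μ.withDensity ψ

/-- The `ψ`-twisted potential functions `G_p^ψ` for a model with terminal time `n`:
`G_0^ψ = (G_0/ψ_0) M_1(ψ_1) M_0(ψ_0)`, `G_p^ψ = (G_p/ψ_p) M_{p+1}(ψ_{p+1})` for
`1 ≤ p ≤ n-1`, and `G_n^ψ = G_n/ψ_n`. -/
def fkTwG {X : Type*} [MeasurableSpace X] (n : ℕ) (M0 : Measure X)
    (M : ℕ → X → Measure X) (G ψ : ℕ → X → ℝ≥0∞) (p : ℕ) (x : X) : ℝ≥0∞ :=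
  G p x * (ψ p x)⁻¹ *
    (if p < n then ∫⁻ y, ψ (p + 1) y ∂(M (p + 1) x) else 1) *
    (if p = 0 then ∫⁻ y, ψ 0 y ∂M0 else 1)

/-- Normalisation of a (finite, nonzero) measure. -/
def fkNorm {X : Type*} [MeasurableSpace X] (μ : Measure X) : Measure X :=
  (μ Set.univ)⁻¹ • μ

/-- The integral of a bounded positive function against a probability measure is nonzero. -/
theorem BddPos.lintegral_ne_zero {X : Type*} [MeasurableSpace X] {f : X → ℝ≥0∞}
    (hf : BddPos f) (μ : Measure X) [IsProbabilityMeasure μ] : ∫⁻ x, f x ∂μ ≠ 0 := by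
  obtain ⟨hm, hpos, -⟩ := hf
  rw [Ne, lintegral_eq_zero_iff hm]
  intro h
  obtain ⟨x, hx⟩ := h.exists
  exact (hpos x).ne' hx

/-- The integral of a bounded positive function against a probability measure is finite. -/
theorem BddPos.lintegral_ne_top {X : Type*} [MeasurableSpace X] {f : X → ℝ≥0∞}
    (hf : BddPos f) (μ : Measure X) [IsProbabilityMeasure μ] : ∫⁻ x, f x ∂μ ≠ ⊤ := by
  obtain ⟨-, -, C, hC, hle⟩ := hf
  refine ne_top_of_le_ne_top hC ((lintegral_mono hle).trans ?_)
  simp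

theorem BddPos.ne_top {X : Type*} [MeasurableSpace X] {f : X → ℝ≥0∞}
    (hf : BddPos f) (x : X) : f x ≠ ⊤ := by
  obtain ⟨-, -, C, hC, hle⟩ := hf
  exact ne_top_of_le_ne_top hC (hle x)

theorem fkTwist_apply {X : Type*} [MeasurableSpace X] (μ : Measure X) (φ : X → ℝ≥0∞)
    {S : Set X} (hS : MeasurableSet S) :
    fkTwist μ φ S = (∫⁻ y, φ y ∂μ)⁻¹ * ∫⁻ y in S, φ y ∂μ := by
  simp [fkTwist, withDensity_apply _ hS]

theorem measurable_fkTwist_kernel {X : Type*} [MeasurableSpace X] (K : Kernel X X)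
    [IsSFiniteKernel K]
    {φ : X → ℝ≥0∞} (hφ : Measurable φ) : Measurable fun x => fkTwist (K x) φ := by
  refine Measure.measurable_of_measurable_coe _ fun S hS => ?_
  simp only [fkTwist_apply _ _ hS]
  exact hφ.lintegral_kernel.inv.mul (hφ.setLIntegral_kernel hS)

/-- One step of the predictive recursion: if `μ` is twisted by `ψ` with a constant `c`, then
propagating it through the kernel twisted by `φ`, with the matching twisted potential, gives the
untwisted step with density `φ`. -/
theorem bind_fkTwist_eq_withDensity {X : Type*} [MeasurableSpace X] (μ : Measure X)
    (K : Kernel X X) [IsMarkovKernel K] {g ψ φ : X → ℝ≥0∞} (hg : Measurable g)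
    (hψ : BddPos ψ) (hφ : BddPos φ) {c d : ℝ≥0∞} (hcd : c * d = 1) :
    ((c • μ.withDensity ψ).withDensity
        fun x => g x * (ψ x)⁻¹ * (∫⁻ y, φ y ∂(K x)) * d).bind (fun x => fkTwist (K x) φ)
      = ((μ.withDensity g).bind K).withDensity φ := by
  have hK : Measurable fun x => ∫⁻ y, φ y ∂(K x) := hφ.1.lintegral_kernel
  have hT := measurable_fkTwist_kernel K hφ.1
  have hgT : Measurable fun x => g x * (ψ x)⁻¹ * (∫⁻ y, φ y ∂(K x)) * d :=
    ((hg.mul hψ.1.inv).mul hK).mul_const d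
  ext S hS
  have hKS : Measurable fun x => ∫⁻ y in S, φ y ∂(K x) := hφ.1.setLIntegral_kernel hS
  have hTS : Measurable fun x => fkTwist (K x) φ S := (Measure.measurable_coe hS).comp hT
  rw [Measure.bind_apply hS hT.aemeasurable, lintegral_withDensity_eq_lintegral_mul _ hgT hTS,
    lintegral_smul_measure, lintegral_withDensity_eq_lintegral_mul _ hψ.1 (hgT.mul hTS),
    smul_eq_mul, ← lintegral_const_mul _ (hψ.1.mul (hgT.mul hTS)), withDensity_apply _ hS,
    ← lintegral_indicator hS, Measure.lintegral_bind K.measurable.aemeasurable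
      (hφ.1.indicator hS).aemeasurable]
  simp only [lintegral_indicator hS]
  rw [lintegral_withDensity_eq_lintegral_mul _ hg hKS]
  refine lintegral_congr fun x => ?_
  simp only [Pi.mul_apply, fkTwist_apply _ _ hS]
  have hψx : ψ x * (ψ x)⁻¹ = 1 := ENNReal.mul_inv_cancel (hψ.2.1 x).ne' (hψ.ne_top x)
  have hKx : (∫⁻ y, φ y ∂(K x)) * (∫⁻ y, φ y ∂(K x))⁻¹ = 1 :=
    ENNReal.mul_inv_cancel (hφ.lintegral_ne_zero _) (hφ.lintegral_ne_top _)
  calc _ = (c * d) * (ψ x * (ψ x)⁻¹) * ((∫⁻ y, φ y ∂(K x)) * (∫⁻ y, φ y ∂(K x))⁻¹)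
        * (g x * ∫⁻ y in S, φ y ∂(K x)) := by ring
    _ = _ := by rw [hcd, hψx, hKx]; simp

theorem fkGamma_twisted_succ {X : Type*} [MeasurableSpace X] (n : ℕ)
    (M0 : Measure X) [IsProbabilityMeasure M0]
    (M : ℕ → Kernel X X) [∀ p, IsMarkovKernel (M p)]
    (G ψ : ℕ → X → ℝ≥0∞)
    (hG : ∀ p ≤ n, BddPos (G p)) (hψ : ∀ p ≤ n, BddPos (ψ p)) (p : ℕ) (hp : p + 1 ≤ n) :
    fkGamma (fkTwist M0 (ψ 0)) (fun q x => fkTwist (M q x) (ψ q))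
        (fkTwG n M0 (fun q x => M q x) G ψ) (p + 1)
      = (fkGamma M0 (fun q x => M q x) G (p + 1)).withDensity (ψ (p + 1)) := by
  induction p with
  | zero =>
    have hcd : (∫⁻ y, ψ 0 y ∂M0)⁻¹ * ∫⁻ y, ψ 0 y ∂M0 = 1 :=
      ENNReal.inv_mul_cancel ((hψ 0 (by lia)).lintegral_ne_zero _)
        ((hψ 0 (by lia)).lintegral_ne_top _)
    have h := bind_fkTwist_eq_withDensity M0 (M 1) (hG 0 (by lia)).1 (hψ 0 (by lia))
      (hψ 1 hp) hcd
    have hT : fkTwG n M0 (fun q x => M q x) G ψ 0 = fun x =>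
        G 0 x * (ψ 0 x)⁻¹ * (∫⁻ y, ψ 1 y ∂(M 1 x)) * ∫⁻ y, ψ 0 y ∂M0 := by
      funext x
      simp [fkTwG, show 0 < n by lia]
    simp only [fkGamma, hT]
    exact h
  | succ p ih =>
    have h := bind_fkTwist_eq_withDensity (fkGamma M0 (fun q x => M q x) G (p + 1)) (M (p + 2))
      (hG (p + 1) (by lia)).1 (hψ (p + 1) (by lia)) (hψ (p + 2) hp) (one_mul 1)
    have hT : fkTwG n M0 (fun q x => M q x) G ψ (p + 1) = fun x =>
        G (p + 1) x * (ψ (p + 1) x)⁻¹ * (∫⁻ y, ψ (p + 2) y ∂(M (p + 2) x)) * 1 := by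
      funext x
      simp [fkTwG, show p + 1 < n by lia]
    rw [fkGamma, ih (by lia), hT]
    rw [one_smul] at h
    exact h

theorem twisted_predictive_marginals {X : Type*} [MeasurableSpace X] (n : ℕ)
    (M0 : Measure X) [IsProbabilityMeasure M0]
    (M : ℕ → Kernel X X) [∀ p, IsMarkovKernel (M p)]
    (G ψ : ℕ → X → ℝ≥0∞)
    (hG : ∀ p ≤ n, BddPos (G p)) (hψ : ∀ p ≤ n, BddPos (ψ p)) :
    (∀ S : Set X, MeasurableSet S →
      fkGamma (fkTwist M0 (ψ 0)) (fun q x => fkTwist (M q x) (ψ q))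
          (fkTwG n M0 (fun q x => M q x) G ψ) 0 S
        = (∫⁻ y, ψ 0 y ∂M0)⁻¹ * ∫⁻ x in S, ψ 0 x ∂(fkGamma M0 (fun q x => M q x) G 0)) ∧
    (∀ p, 1 ≤ p → p ≤ n → ∀ S : Set X, MeasurableSet S →
      fkGamma (fkTwist M0 (ψ 0)) (fun q x => fkTwist (M q x) (ψ q))
          (fkTwG n M0 (fun q x => M q x) G ψ) p S
        = ∫⁻ x in S, ψ p x ∂(fkGamma M0 (fun q x => M q x) G p)) := by
  refine ⟨fun S hS => fkTwist_apply _ _ hS, fun p hp hpn S hS => ?_⟩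
  obtain ⟨q, rfl⟩ := Nat.exists_eq_add_of_le' hp
  rw [fkGamma_twisted_succ n M0 M G ψ hG hψ q hpn, withDensity_apply _ hS]

end
end

section
/- Define the optimal twisting functions recursively by ψ_n^* = G_n and ψ_p^* = G_p · M_{p+1}(ψ_{p+1}^*) for p = n−1, …, 0. Then the twisted potentials of the ψ*-twisted model are constant: G_p^{ψ*}(x) = 1 for every x ∈ X and every p ∈ {1, …, n}, and G_0^{ψ*}(x) = M_0(ψ_0^*) for every x ∈ X. -/
open MeasureTheory ProbabilityTheory ENNReal

noncomputable section

def fkOptPsiAux {X : Type*} [MeasurableSpace X] (n : ℕ) (M : ℕ → X → Measure X)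
    (G : ℕ → X → ℝ≥0∞) : ℕ → X → ℝ≥0∞
  | 0 => G n
  | k + 1 => fun x => G (n - (k + 1)) x * ∫⁻ y, fkOptPsiAux n M G k y ∂(M (n - k) x)

/-- The optimal twisting functions `ψ_p^⋆`, defined by the backward recursion
`ψ_n^⋆ = G_n` and `ψ_p^⋆ = G_p ⋅ M_{p+1}(ψ_{p+1}^⋆)` for `p = n-1, …, 0`. -/
def fkOptPsi {X : Type*} [MeasurableSpace X] (n : ℕ) (M : ℕ → X → Measure X)
    (G : ℕ → X → ℝ≥0∞) (p : ℕ) : X → ℝ≥0∞ :=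
  fkOptPsiAux n M G (n - p)

theorem BddPos.mul {X : Type*} [MeasurableSpace X] {f g : X → ℝ≥0∞}
    (hf : BddPos f) (hg : BddPos g) : BddPos (fun x => f x * g x) := by
  obtain ⟨hfm, hfp, C, hC, hfC⟩ := hf
  obtain ⟨hgm, hgp, D, hD, hgD⟩ := hg
  exact ⟨hfm.mul hgm, fun x => ENNReal.mul_pos (hfp x).ne' (hgp x).ne',
    C * D, ENNReal.mul_ne_top hC hD, fun x => mul_le_mul' (hfC x) (hgD x)⟩

theorem BddPos.ne_zero {X : Type*} [MeasurableSpace X] {f : X → ℝ≥0∞}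
    (hf : BddPos f) (x : X) : f x ≠ 0 :=
  (hf.2.1 x).ne'

theorem BddPos.lintegral_kernel {X Y : Type*} [MeasurableSpace X] [MeasurableSpace Y]
    {f : Y → ℝ≥0∞} (hf : BddPos f) (κ : Kernel X Y) [IsMarkovKernel κ] :
    BddPos (fun x => ∫⁻ y, f y ∂(κ x)) := by
  obtain ⟨hfm, hfp, C, hC, hfC⟩ := hf
  refine ⟨hfm.lintegral_kernel, fun x => ?_, C, hC, fun x => ?_⟩
  · have h_supp : Function.support f = Set.univ :=
      Set.eq_univ_of_forall fun y => (hfp y).ne'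
    simp [lintegral_pos_iff_support hfm, h_supp]
  · calc ∫⁻ y, f y ∂(κ x) ≤ ∫⁻ _, C ∂(κ x) := lintegral_mono hfC
      _ = C := by simp

theorem fkOptPsi_self {X : Type*} [MeasurableSpace X] (n : ℕ) (M : ℕ → X → Measure X)
    (G : ℕ → X → ℝ≥0∞) : fkOptPsi n M G n = G n := by
  simp [fkOptPsi, fkOptPsiAux]

theorem fkOptPsi_of_lt {X : Type*} [MeasurableSpace X] {n p : ℕ} (hp : p < n)
    (M : ℕ → X → Measure X) (G : ℕ → X → ℝ≥0∞) :
    fkOptPsi n M G p = fun x => G p x * ∫⁻ y, fkOptPsi n M G (p + 1) y ∂(M (p + 1) x) := by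
  obtain ⟨k, rfl⟩ := Nat.exists_eq_add_of_lt hp
  have h₁ : p + k + 1 - p = k + 1 := by omega
  have h₂ : p + k + 1 - (p + 1) = k := by omega
  have h₃ : p + k + 1 - (k + 1) = p := by omega
  have h₄ : p + k + 1 - k = p + 1 := by omega
  simp only [fkOptPsi, h₁, h₂, fkOptPsiAux, h₃, h₄]

theorem bddPos_fkOptPsi {X : Type*} [MeasurableSpace X] {n : ℕ}
    (M : ℕ → Kernel X X) [∀ p, IsMarkovKernel (M p)]
    {G : ℕ → X → ℝ≥0∞} (hG : ∀ p ≤ n, BddPos (G p)) {p : ℕ} (hp : p ≤ n) :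
    BddPos (fkOptPsi n (fun q x => M q x) G p) := by
  induction hp using Nat.decreasingInduction with
  | self => rw [fkOptPsi_self]; exact hG n le_rfl
  | of_succ p hp ih =>
    rw [fkOptPsi_of_lt hp]
    exact (hG p hp.le).mul (ih.lintegral_kernel (M (p + 1)))

theorem fkTwG_fkOptPsi {X : Type*} [MeasurableSpace X] {n : ℕ} (M0 : Measure X)
    (M : ℕ → Kernel X X) [∀ p, IsMarkovKernel (M p)]
    {G : ℕ → X → ℝ≥0∞} (hG : ∀ p ≤ n, BddPos (G p)) {p : ℕ} (hp : p ≤ n) (x : X) :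
    fkTwG n M0 (fun q x => M q x) G (fkOptPsi n (fun q x => M q x) G) p x
      = if p = 0 then ∫⁻ y, fkOptPsi n (fun q x => M q x) G 0 y ∂M0 else 1 := by
  have hψ := bddPos_fkOptPsi M hG hp
  have h_cancel := ENNReal.mul_inv_cancel (hψ.ne_zero x) (hψ.ne_top x)
  have h_rec : G p x * (if p < n then
      ∫⁻ y, fkOptPsi n (fun q x => M q x) G (p + 1) y ∂(M (p + 1) x) else 1)
      = fkOptPsi n (fun q x => M q x) G p x := by
    split_ifs with h
    · rw [fkOptPsi_of_lt h]
    · obtain rfl : p = n := by omega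
      rw [fkOptPsi_self, mul_one]
  rw [fkTwG, mul_right_comm (G p x), h_rec, h_cancel, one_mul]

theorem optimal_twisting_constant_potentials {X : Type*} [MeasurableSpace X] (n : ℕ)
    (M0 : Measure X) [IsProbabilityMeasure M0]
    (M : ℕ → Kernel X X) [∀ p, IsMarkovKernel (M p)]
    (G : ℕ → X → ℝ≥0∞) (hG : ∀ p ≤ n, BddPos (G p)) :
    (∀ p, 1 ≤ p → p ≤ n → ∀ x : X,
      fkTwG n M0 (fun q x => M q x) G (fkOptPsi n (fun q x => M q x) G) p x = 1) ∧
    (∀ x : X,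
      fkTwG n M0 (fun q x => M q x) G (fkOptPsi n (fun q x => M q x) G) 0 x
        = ∫⁻ y, fkOptPsi n (fun q x => M q x) G 0 y ∂M0) := by
  refine ⟨fun p hp hpn x => ?_, fun x => ?_⟩
  · rw [fkTwG_fkOptPsi M0 M hG hpn, if_neg (by omega)]
  · rw [fkTwG_fkOptPsi M0 M hG n.zero_le, if_pos rfl]

end
end

section
/- For each p ∈ {0, …, n}, the time-p predictive marginal measure γ̃_p of the random-weight model satisfies γ̃_p(d(x_p, u_p)) = γ_p(dx_p) K_p(x_p, du_p): that is, for every measurable rectangle A × B with A ∈ 𝒳 and B ∈ 𝒰, γ̃_p(A × B) = ∫_A K_p(x_p, B) γ_p(dx_p). -/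
open MeasureTheory ProbabilityTheory ENNReal

noncomputable section

/-- Composing with a fixed Markov kernel after a kernel `M` is measurable in the starting point. -/
theorem measurable_kernel_compProd {X U : Type*} [MeasurableSpace X] [MeasurableSpace U]
    (M : Kernel X X) [IsMarkovKernel M] (K : Kernel X U) [IsMarkovKernel K] :
    Measurable fun x => (M x).compProd K := by
  refine Measure.measurable_of_measurable_coe _ fun s hs => ?_
  simp_rw [Measure.compProd_apply hs]
  exact (Kernel.measurable_kernel_prodMk_left hs).lintegral_kernel

/-- One step of the random-weight recursion integrates the auxiliary variable out. -/
theorem bind_withDensity_compProd {X U : Type*} [MeasurableSpace X] [MeasurableSpace U]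
    (μ : Measure X) [SFinite μ] (M : Kernel X X) [IsMarkovKernel M]
    (K K' : Kernel X U) [IsMarkovKernel K] [IsMarkovKernel K']
    {g : X → ℝ≥0∞} {h : X × U → ℝ≥0∞} (hg : Measurable g) (hh : Measurable h)
    (hgh : ∀ x, ∫⁻ u, h (x, u) ∂(K x) = g x) :
    ((μ.compProd K).withDensity h).bind (fun z => (M z.1).compProd K')
      = ((μ.withDensity g).bind M).compProd K' := by
  ext s hs
  have hM : Measurable fun z : X × U => (M z.1).compProd K' :=
    (measurable_kernel_compProd M K').comp measurable_fst
  have hMs : Measurable fun z : X × U => (M z.1).compProd K' s :=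
    (Measure.measurable_coe hs).comp hM
  have hK : Measurable fun y => K' y (Prod.mk y ⁻¹' s) :=
    Kernel.measurable_kernel_prodMk_left hs
  rw [Measure.bind_apply hs hM.aemeasurable,
    lintegral_withDensity_eq_lintegral_mul _ hh hMs,
    Measure.lintegral_compProd (hh.mul hMs), Measure.compProd_apply hs,
    Measure.lintegral_bind M.measurable.aemeasurable hK.aemeasurable,
    lintegral_withDensity_eq_lintegral_mul _ hg hK.lintegral_kernel]
  refine lintegral_congr fun x => ?_
  simp only [Pi.mul_apply]
  have hx : Measurable fun u => h (x, u) := hh.comp measurable_prodMk_left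
  rw [lintegral_mul_const _ hx, hgh, Measure.compProd_apply hs]

theorem sFinite_fkGamma {X : Type*} [MeasurableSpace X] (M0 : Measure X) [SFinite M0]
    (M : ℕ → Kernel X X) [∀ p, IsMarkovKernel (M p)] (G : ℕ → X → ℝ≥0∞) (p : ℕ) :
    SFinite (fkGamma M0 (fun q x => M q x) G p) := by
  induction p with
  | zero => simpa only [fkGamma]
  | succ p ih =>
    rw [fkGamma]
    exact inferInstanceAs (SFinite (Measure.bind _ (M (p + 1))))

theorem random_weight_marginals {X U : Type*} [MeasurableSpace X] [MeasurableSpace U] (n : ℕ)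
    (M0 : Measure X) [IsProbabilityMeasure M0]
    (M : ℕ → Kernel X X) [∀ p, IsMarkovKernel (M p)]
    (K : ℕ → Kernel X U) [∀ p, IsMarkovKernel (K p)]
    (G : ℕ → X → ℝ≥0∞) (Gt : ℕ → X × U → ℝ≥0∞)
    (hG : ∀ p ≤ n, BddPos (G p)) (hGt : ∀ p ≤ n, BddPos (Gt p))
    (hunb : ∀ p ≤ n, ∀ x : X, ∫⁻ u, Gt p (x, u) ∂(K p x) = G p x) :
    ∀ p ≤ n, ∀ A : Set X, ∀ B : Set U, MeasurableSet A → MeasurableSet B →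
      fkGamma (M0.compProd (K 0)) (fun q z => (M q z.1).compProd (K q)) Gt p (A ×ˢ B)
        = ∫⁻ x in A, K p x B ∂(fkGamma M0 (fun q x => M q x) G p) := by
  have key : ∀ p ≤ n, fkGamma (M0.compProd (K 0)) (fun q z => (M q z.1).compProd (K q)) Gt p
      = (fkGamma M0 (fun q x => M q x) G p).compProd (K p) := by
    intro p
    induction p with
    | zero => intro _; rfl
    | succ p ih =>
      intro hp
      have hpn : p ≤ n := by lia
      have := sFinite_fkGamma M0 M G p
      rw [fkGamma, ih hpn]
      exact bind_withDensity_compProd _ (M (p + 1)) (K p) (K (p + 1)) (hG p hpn).1 (hGt p hpn).1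
        (hunb p hpn)
  intro p hp A B hA hB
  have := sFinite_fkGamma M0 M G p
  rw [key p hp, Measure.compProd_apply_prod hA hB]

end
end

section
/- For each p ∈ {0, …, n−1}, the product kernels of the random-weight model satisfy Q̃_{p,n}((x_p, u_p), S) = (G̃_p(x_p, u_p)/G_p(x_p)) · R_{p,n}(x_p, S) for every (x_p, u_p) ∈ X × U and measurable S ⊆ X × U, where R_{p,n}(x_p, d(x_n, u_n)) = Q_{p,n}(x_p, dx_n) K_n(x_n, du_n), i.e. R_{p,n}(x_p, S) = ∫ Q_{p,n}(x_p, dx_n) ∫ 1_S(x_n, u_n) K_n(x_n, du_n). -/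
open MeasureTheory ProbabilityTheory ENNReal

noncomputable section

/-- The nonnegative kernel `Q_p(x, dy) = G_{p-1}(x) M_p(x, dy)`. -/
def fkQ {X : Type*} [MeasurableSpace X] (M : ℕ → X → Measure X)
    (G : ℕ → X → ℝ≥0∞) (p : ℕ) (x : X) : Measure X :=
  G (p - 1) x • M p x

def fkQProdAux {X : Type*} [MeasurableSpace X] (M : ℕ → X → Measure X)
    (G : ℕ → X → ℝ≥0∞) (n : ℕ) : ℕ → X → Measure X
  | 0 => fun x => Measure.dirac x
  | k + 1 => fun x => (fkQ M G (n - k) x).bind (fkQProdAux M G n k)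

/-- The product kernel `Q_{p,n} = Q_{p+1} ⋯ Q_n` (with `Q_{n,n} = Id`). -/
def fkQProd {X : Type*} [MeasurableSpace X] (M : ℕ → X → Measure X)
    (G : ℕ → X → ℝ≥0∞) (n p : ℕ) : X → Measure X :=
  fkQProdAux M G n (n - p)

/-- Iterated products of measurable kernels with measurable potentials are measurable. -/
theorem measurable_fkQProdAux {X : Type*} [MeasurableSpace X] {M : ℕ → X → Measure X}
    {G : ℕ → X → ℝ≥0∞} {n : ℕ} (hM : ∀ p, Measurable (M p))
    (hG : ∀ p ≤ n, Measurable (G p)) (k : ℕ) : Measurable (fkQProdAux M G n k) := by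
  induction k with
  | zero => exact Measure.measurable_dirac
  | succ k ih =>
    refine (Measure.measurable_bind' ih).comp
      (Measure.measurable_of_measurable_coe _ fun s hs => ?_)
    simp only [fkQ, Measure.smul_apply, smul_eq_mul]
    exact (hG _ (by omega)).mul ((Measure.measurable_coe hs).comp (hM _))

/-- Integration against one more step of the product kernel. -/
theorem lintegral_fkQProdAux_succ {X : Type*} [MeasurableSpace X] {M : ℕ → X → Measure X}
    {G : ℕ → X → ℝ≥0∞} {n : ℕ} (hM : ∀ p, Measurable (M p))
    (hG : ∀ p ≤ n, Measurable (G p)) (k : ℕ) (x : X) {f : X → ℝ≥0∞} (hf : Measurable f) :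
    ∫⁻ z, f z ∂(fkQProdAux M G n (k + 1) x)
      = G (n - (k + 1)) x * ∫⁻ y, ∫⁻ z, f z ∂(fkQProdAux M G n k y) ∂(M (n - k) x) := by
  rw [fkQProdAux, Measure.lintegral_bind (measurable_fkQProdAux hM hG k).aemeasurable
    hf.aemeasurable, fkQ, lintegral_smul_measure, smul_eq_mul, Nat.sub_sub]

section RandomWeight

variable {X U : Type*} [MeasurableSpace X] [MeasurableSpace U] {n : ℕ}
  {M : ℕ → Kernel X X} [∀ p, IsMarkovKernel (M p)] {K : ℕ → Kernel X U} [∀ p, IsMarkovKernel (K p)]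
  {Gt : ℕ → X × U → ℝ≥0∞}

theorem measurable_compProd_fst (q : ℕ) :
    Measurable fun z : X × U => (M q z.1).compProd (K q) := by
  refine Measure.measurable_of_measurable_coe _ fun s hs => ?_
  simp only [Measure.compProd_apply hs]
  exact ((Kernel.measurable_kernel_prodMk_left hs).lintegral_kernel (κ := M q)).comp measurable_fst

/-- One step of the product kernel of the random-weight model. -/
theorem fkQProdAux_randomWeight_succ (hGt : ∀ p ≤ n, Measurable (Gt p)) (k : ℕ) (z : X × U)
    {S : Set (X × U)} (hS : MeasurableSet S) :
    fkQProdAux (fun q z => (M q z.1).compProd (K q)) Gt n (k + 1) z S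
      = Gt (n - (k + 1)) z * ∫⁻ y, ∫⁻ v,
          fkQProdAux (fun q z => (M q z.1).compProd (K q)) Gt n k (y, v) S
            ∂(K (n - k) y) ∂(M (n - k) z.1) := by
  have hm := measurable_fkQProdAux (measurable_compProd_fst (M := M) (K := K)) hGt k
  rw [← lintegral_indicator_one hS, lintegral_fkQProdAux_succ measurable_compProd_fst hGt k z
    (measurable_one.indicator hS)]
  simp only [lintegral_indicator_one hS]
  exact congrArg _ (Measure.lintegral_compProd ((Measure.measurable_coe hS).comp hm))

/-- Averaging the random-weight product kernel over the initial weight gives the product kernel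
of the original model followed by a draw of the terminal weight. -/
theorem lintegral_fkQProdAux_randomWeight {G : ℕ → X → ℝ≥0∞}
    (hG : ∀ p ≤ n, Measurable (G p)) (hGt : ∀ p ≤ n, Measurable (Gt p))
    (hunb : ∀ p ≤ n, ∀ x : X, ∫⁻ u, Gt p (x, u) ∂(K p x) = G p x) (k : ℕ) (x : X)
    {S : Set (X × U)} (hS : MeasurableSet S) :
    ∫⁻ u, fkQProdAux (fun q z => (M q z.1).compProd (K q)) Gt n k (x, u) S ∂(K (n - k) x)
      = ∫⁻ y, K n y (Prod.mk y ⁻¹' S) ∂(fkQProdAux (fun q x => M q x) G n k x) := by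
  have hK : Measurable fun y => K n y (Prod.mk y ⁻¹' S) := Kernel.measurable_kernel_prodMk_left hS
  induction k generalizing x with
  | zero =>
    simp only [fkQProdAux, Nat.sub_zero]
    rw [lintegral_dirac' _ hK, ← lintegral_indicator_one (measurable_prodMk_left hS)]
    simp only [Measure.dirac_apply' _ hS]
    rfl
  | succ k ih =>
    simp only [fkQProdAux_randomWeight_succ hGt k _ hS, ih]
    have hGtx : Measurable fun u => Gt (n - (k + 1)) (x, u) :=
      (hGt _ (Nat.sub_le _ _)).comp measurable_prodMk_left
    rw [lintegral_fkQProdAux_succ (fun q => (M q).measurable) hG k x hK,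
      lintegral_mul_const _ hGtx, hunb _ (Nat.sub_le _ _)]

end RandomWeight

theorem random_weight_product_kernels {X U : Type*} [MeasurableSpace X] [MeasurableSpace U] (n : ℕ)
    (M0 : Measure X) [IsProbabilityMeasure M0]
    (M : ℕ → Kernel X X) [∀ p, IsMarkovKernel (M p)]
    (K : ℕ → Kernel X U) [∀ p, IsMarkovKernel (K p)]
    (G : ℕ → X → ℝ≥0∞) (Gt : ℕ → X × U → ℝ≥0∞)
    (hG : ∀ p ≤ n, BddPos (G p)) (hGt : ∀ p ≤ n, BddPos (Gt p))
    (hunb : ∀ p ≤ n, ∀ x : X, ∫⁻ u, Gt p (x, u) ∂(K p x) = G p x) :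
    ∀ p < n, ∀ x : X, ∀ u : U, ∀ S : Set (X × U), MeasurableSet S →
      fkQProd (fun q z => (M q z.1).compProd (K q)) Gt n p (x, u) S
        = (Gt p (x, u) / G p x) *
            ∫⁻ y, K n y (Prod.mk y ⁻¹' S) ∂(fkQProd (fun q x => M q x) G n p x) := by
  intro p hp x u S hS
  have hGm := fun p hp => (hG p hp).1
  have hGtm := fun p hp => (hGt p hp).1
  obtain ⟨-, hpos, C, hC, hle⟩ := hG p hp.le
  obtain ⟨k, rfl⟩ : ∃ k, n = p + (k + 1) := ⟨n - p - 1, by omega⟩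
  have hK : Measurable fun y => K (p + (k + 1)) y (Prod.mk y ⁻¹' S) :=
    Kernel.measurable_kernel_prodMk_left hS
  simp only [fkQProd, Nat.add_sub_cancel_left]
  rw [fkQProdAux_randomWeight_succ hGtm k _ hS,
    lintegral_fkQProdAux_succ (fun q => (M q).measurable) hGm k x hK]
  simp only [lintegral_fkQProdAux_randomWeight hGm hGtm hunb k _ hS, Nat.add_sub_cancel]
  rw [← mul_assoc, ENNReal.div_mul_cancel (hpos x).ne' (ne_top_of_le_ne_top hC (hle x))]

end
end

section
/- Define s_p(x) = ∫_U (G̃_p(x, u)/G_p(x))² K_p(x, du) for p ∈ {0, …, n−1} and s_n ≡ 1, and suppose sup_{p ∈ {0,…,n}} sup_{x ∈ X} s_p(x) ≤ C + 1 for some 0 < C < ∞. Then for every bounded measurable φ : X → ℝ and each p ∈ {0, …, n}, the random-weight asymptotic variance terms satisfy v̄_{p,n}(φ) ≤ (C+1) v_{p,n}(φ) + C η_n(φ)², where v̄_{p,n}(φ) = γ_p(X) γ_p(s_p · Q_{p,n}(φ)²)/γ_n(X)² − η_n(φ)² and v_{p,n}(φ) = γ_p(X) γ_p(Q_{p,n}(φ)²)/γ_n(X)²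 − η_n(φ)². -/
open MeasureTheory ProbabilityTheory ENNReal

noncomputable section

/-- The relative second moment `s_p(x) = ∫_U (G̃_p(x,u)/G_p(x))² K_p(x, du)` for
`p < n`, with `s_n ≡ 1`. -/
def rwS {X U : Type*} [MeasurableSpace X] [MeasurableSpace U] (n : ℕ)
    (K : ℕ → Kernel X U) (G : ℕ → X → ℝ≥0∞) (Gt : ℕ → X × U → ℝ≥0∞)
    (p : ℕ) (x : X) : ℝ≥0∞ :=
  if p < n then ∫⁻ u, (Gt p (x, u) / G p x) ^ 2 ∂(K p x) else 1

/-- The predictive marginals of a model with bounded potentials are finite measures. -/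
lemma isFiniteMeasure_fkGamma {X : Type*} [MeasurableSpace X] {n : ℕ}
    (M0 : Measure X) [IsFiniteMeasure M0]
    (M : ℕ → Kernel X X) [∀ p, IsMarkovKernel (M p)] {G : ℕ → X → ℝ≥0∞}
    (hG : ∀ p ≤ n, BddPos (G p)) :
    ∀ p ≤ n, IsFiniteMeasure (fkGamma M0 (fun q x => M q x) G p)
  | 0, _ => by rw [fkGamma]; infer_instance
  | p + 1, hp => by
    have := isFiniteMeasure_fkGamma M0 M hG p (by omega)
    obtain ⟨-, -, B, hB, hGB⟩ := hG p (by omega)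
    have : IsFiniteMeasure ((fkGamma M0 (fun q x => M q x) G p).withDensity (G p)) := by
      refine isFiniteMeasure_withDensity ?_
      refine ((lintegral_mono hGB).trans_lt ?_).ne
      rw [lintegral_const]
      exact ENNReal.mul_lt_top hB.lt_top (measure_lt_top _ _)
    rw [fkGamma]
    change IsFiniteMeasure (Measure.bind _ (M (p + 1)))
    infer_instance

/-- The products of the kernels `Q_p` are finite kernels when the potentials are bounded. -/
lemma exists_isFiniteKernel_eq_fkQProdAux {X : Type*} [MeasurableSpace X] {n : ℕ}
    (M : ℕ → Kernel X X) [∀ p, IsMarkovKernel (M p)] {G : ℕ → X → ℝ≥0∞}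
    (hG : ∀ p ≤ n, BddPos (G p)) (k : ℕ) :
    ∃ κ : Kernel X X, IsFiniteKernel κ ∧ ∀ x, κ x = fkQProdAux (fun q x => M q x) G n k x := by
  induction k with
  | zero => exact ⟨Kernel.id, inferInstance, fun x => Kernel.id_apply x⟩
  | succ k ih =>
    obtain ⟨κ, hκ, hκ_eq⟩ := ih
    obtain ⟨hGm, -, B, hB, hGB⟩ := hG (n - k - 1) (by omega)
    let Q : Kernel X X :=
      ⟨fun x => G (n - k - 1) x • M (n - k) x,
        Measure.measurable_of_measurable_coe _ fun s hs => by
          exact hGm.mul ((M (n - k)).measurable_coe hs)⟩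
    have hQ : IsFiniteKernel Q :=
      ⟨B, hB.lt_top, fun x => by
        change (G (n - k - 1) x • M (n - k) x) Set.univ ≤ B
        simpa using hGB x⟩
    refine ⟨κ ∘ₖ Q, inferInstance, fun x => ?_⟩
    rw [Kernel.comp_apply, funext hκ_eq]
    rfl

/-- The function `Q_{p,n}(φ)` is square integrable under any finite measure,
for bounded measurable `φ`. -/
lemma integrable_sq_integral_fkQProd {X : Type*} [MeasurableSpace X] {n : ℕ}
    (M : ℕ → Kernel X X) [∀ p, IsMarkovKernel (M p)] {G : ℕ → X → ℝ≥0∞}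
    (hG : ∀ p ≤ n, BddPos (G p)) (p : ℕ) (μ : Measure X) [IsFiniteMeasure μ]
    {φ : X → ℝ} (hφ : Measurable φ) {D : ℝ} (hD : ∀ x, |φ x| ≤ D) :
    Integrable (fun x => (∫ y, φ y ∂(fkQProd (fun q x => M q x) G n p x)) ^ 2) μ := by
  obtain ⟨κ, hκ, hκ_eq⟩ := exists_isFiniteKernel_eq_fkQProdAux M hG (n - p)
  simp only [fkQProd, ← hκ_eq]
  have hm : StronglyMeasurable fun x => ∫ y, φ y ∂(κ x) :=
    hφ.stronglyMeasurable.integral_kernel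
  refine Integrable.of_bound (hm.pow 2).aestronglyMeasurable
    ((D * κ.bound.toReal) ^ 2) (ae_of_all _ fun x => ?_)
  rw [norm_pow]
  have hD0 : 0 ≤ D := (abs_nonneg _).trans (hD x)
  gcongr
  refine (norm_integral_le_of_norm_le_const (ae_of_all _ hD)).trans ?_
  gcongr
  exact ENNReal.toReal_mono κ.bound_ne_top (κ.measure_le_bound x _)

theorem random_weight_variance_term_bound {X U : Type*} [MeasurableSpace X] [MeasurableSpace U] (n : ℕ)
    (M0 : Measure X) [IsProbabilityMeasure M0]
    (M : ℕ → Kernel X X) [∀ p, IsMarkovKernel (M p)]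
    (K : ℕ → Kernel X U) [∀ p, IsMarkovKernel (K p)]
    (G : ℕ → X → ℝ≥0∞) (Gt : ℕ → X × U → ℝ≥0∞)
    (hG : ∀ p ≤ n, BddPos (G p)) (hGt : ∀ p ≤ n, BddPos (Gt p))
    (hunb : ∀ p ≤ n, ∀ x : X, ∫⁻ u, Gt p (x, u) ∂(K p x) = G p x)
    (C : ℝ) (hC : 0 < C)
    (hs : ∀ p ≤ n, ∀ x : X, rwS n K G Gt p x ≤ ENNReal.ofReal (C + 1))
    (hZ : 0 < fkGamma M0 (fun q x => M q x) G n Set.univ) :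
    ∀ p ≤ n, ∀ φ : X → ℝ, Measurable φ → (∃ D : ℝ, ∀ x, |φ x| ≤ D) →
      (fkGamma M0 (fun q x => M q x) G p Set.univ).toReal *
            (∫ x, (rwS n K G Gt p x).toReal *
              (∫ y, φ y ∂(fkQProd (fun q x => M q x) G n p x)) ^ 2
              ∂(fkGamma M0 (fun q x => M q x) G p)) /
            (fkGamma M0 (fun q x => M q x) G n Set.univ).toReal ^ 2
          - (∫ x, φ x ∂(fkNorm (fkGamma M0 (fun q x => M q x) G n))) ^ 2
        ≤ (C + 1) *
              ((fkGamma M0 (fun q x => M q x) G p Set.univ).toReal *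
                  (∫ x, (∫ y, φ y ∂(fkQProd (fun q x => M q x) G n p x)) ^ 2
                    ∂(fkGamma M0 (fun q x => M q x) G p)) /
                  (fkGamma M0 (fun q x => M q x) G n Set.univ).toReal ^ 2
                - (∫ x, φ x ∂(fkNorm (fkGamma M0 (fun q x => M q x) G n))) ^ 2)
          + C * (∫ x, φ x ∂(fkNorm (fkGamma M0 (fun q x => M q x) G n))) ^ 2 := by
  rintro p hp φ hφ ⟨D, hD⟩
  have := isFiniteMeasure_fkGamma M0 M hG p hp
  have hint := integrable_sq_integral_fkQProd M hG p (fkGamma M0 (fun q x => M q x) G p) hφ hD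
  have hle : ∫ x, (rwS n K G Gt p x).toReal *
        (∫ y, φ y ∂(fkQProd (fun q x => M q x) G n p x)) ^ 2
        ∂(fkGamma M0 (fun q x => M q x) G p)
      ≤ (C + 1) * ∫ x, (∫ y, φ y ∂(fkQProd (fun q x => M q x) G n p x)) ^ 2
        ∂(fkGamma M0 (fun q x => M q x) G p) := by
    rw [← integral_const_mul]
    refine integral_mono_of_nonneg (ae_of_all _ fun x => by positivity)
      (hint.const_mul _) (ae_of_all _ fun x => ?_)
    exact mul_le_mul_of_nonneg_right
      (ENNReal.toReal_le_of_le_ofReal (by positivity) (hs p hp x)) (sq_nonneg _)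
  have hdiv := div_le_div_of_nonneg_right
    (mul_le_mul_of_nonneg_left hle
      (ENNReal.toReal_nonneg (a := fkGamma M0 (fun q x => M q x) G p Set.univ)))
    (sq_nonneg (fkGamma M0 (fun q x => M q x) G n Set.univ).toReal)
  rw [mul_left_comm, mul_div_assoc (C + 1)] at hdiv
  linarith

end
end
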